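/- Let σ ∈ ℝ with 0 < σ < 1, ε ∈ ℝ, c ∈ ℂ, and X > 0. Then c · ∫_0^X φ(−σ, ε, −c t) dt = 1/Γ(ε + σ) − φ(−σ, ε + σ, −cX). -/

import Mathlib

/-- The Wright function `φ(-σ, ε, z) = ∑ z^k/(k! Γ(-σk+ε))`. -/
noncomputable def wrightPhi (σ ε : ℝ) (z : ℂ) : ℂ :=
  ∑' m : ℕ, z ^ m / ((m.factorial : ℂ) * Complex.Gamma (-(σ : ℂ) * m + (ε : ℂ)))

/-- The reflection formula bounds the reciprocal Gamma function to the left of `1`. -/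
lemma abs_inv_Gamma_le_Gamma_one_sub {x : ℝ} (hx : x < 1) :
    |(Real.Gamma x)⁻¹| ≤ Real.Gamma (1 - x) := by
  have hpos : 0 < Real.Gamma (1 - x) := Real.Gamma_pos_of_pos (by linarith)
  have hrefl := Real.Gamma_mul_Gamma_one_sub x
  rcases eq_or_ne (Real.sin (Real.pi * x)) 0 with hs | hs
  · rw [hs, div_zero, mul_eq_zero, or_iff_left hpos.ne'] at hrefl
    simpa [hrefl] using hpos.le
  · have h_inv : (Real.Gamma x)⁻¹
        = Real.Gamma (1 - x) * (Real.sin (Real.pi * x) / Real.pi) := by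
      refine inv_eq_of_mul_eq_one_right ?_
      rw [← mul_assoc, hrefl, div_mul_div_cancel₀ hs, div_self Real.pi_ne_zero]
    rw [h_inv, abs_mul, abs_of_pos hpos]
    refine mul_le_of_le_one_right hpos.le ?_
    rw [abs_div, abs_of_pos Real.pi_pos, div_le_one Real.pi_pos]
    linarith [Real.abs_sin_le_one (Real.pi * x), Real.pi_gt_three]

/-- A consequence of the logarithmic convexity of the Gamma function. -/
lemma Gamma_add_le_rpow_mul_Gamma {σ y : ℝ} (hσ1 : 0 < σ) (hσ2 : σ < 1) (hy : 0 < y) :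
    Real.Gamma (y + σ) ≤ y ^ σ * Real.Gamma y := by
  have hΓ := Real.Gamma_pos_of_pos hy
  have h := Real.Gamma_mul_add_mul_le_rpow_Gamma_mul_rpow_Gamma hy (by linarith : 0 < y + 1)
    (sub_pos.2 hσ2) hσ1 (by ring)
  rw [Real.Gamma_add_one hy.ne', Real.mul_rpow hy.le hΓ.le] at h
  calc Real.Gamma (y + σ) = Real.Gamma ((1 - σ) * y + σ * (y + 1)) := by ring_nf
    _ ≤ _ := h
    _ = y ^ σ * (Real.Gamma y ^ (1 - σ) * Real.Gamma y ^ σ) := by ring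
    _ = y ^ σ * Real.Gamma y := by
      rw [← Real.rpow_add hΓ, sub_add_cancel, Real.rpow_one]

lemma tendsto_mul_rpow_affine_div {σ : ℝ} (hσ1 : 0 < σ) (hσ2 : σ < 1) (r b : ℝ) :
    Filter.Tendsto (fun k : ℕ => r * (b + σ * k) ^ σ / ((k : ℝ) + 1)) Filter.atTop (nhds 0) := by
  have hy : Filter.Tendsto (fun k : ℕ => b + σ * (k : ℝ)) Filter.atTop Filter.atTop :=
    Filter.tendsto_atTop_add_const_left _ _
      (tendsto_natCast_atTop_atTop.const_mul_atTop hσ1)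
  have h1 : (fun y : ℝ => y ^ σ) =o[Filter.atTop] id := by
    refine Asymptotics.isLittleO_of_tendsto'
      ((Filter.eventually_ne_atTop 0).mono fun y hy h => absurd h hy) ?_
    refine (tendsto_rpow_neg_atTop (sub_pos.2 hσ2)).congr' ?_
    filter_upwards [Filter.eventually_gt_atTop 0] with y hy
    rw [neg_sub, Real.rpow_sub_one hy.ne', id]
  have h2 := h1.comp_tendsto hy
  have h3 : (fun k : ℕ => b + σ * (k : ℝ)) =O[Filter.atTop] (fun k : ℕ => (k : ℝ) + 1) := by
    refine Asymptotics.IsBigO.of_bound (|b| + σ) (Filter.Eventually.of_forall fun k => ?_)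
    have hk : (0 : ℝ) ≤ k := k.cast_nonneg
    rw [Real.norm_eq_abs, Real.norm_of_nonneg (by positivity)]
    calc |b + σ * k| ≤ |b| + |σ * k| := abs_add_le _ _
      _ = |b| + σ * k := by rw [abs_of_nonneg (by positivity : 0 ≤ σ * k)]
      _ ≤ _ := by nlinarith [abs_nonneg b, mul_nonneg (abs_nonneg b) hk]
  have h4 : (fun k : ℕ => r * (b + σ * (k : ℝ)) ^ σ) =o[Filter.atTop]
      (fun k : ℕ => (k : ℝ) + 1) := by
    refine Asymptotics.IsLittleO.const_mul_left (h2.trans_isBigO ?_) r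
    exact h3
  exact h4.tendsto_div_nhds_zero

lemma summable_pow_mul_Gamma_affine_div_factorial {σ : ℝ} (hσ1 : 0 < σ) (hσ2 : σ < 1) (b : ℝ)
    {r : ℝ} (hr : 0 ≤ r) :
    Summable fun k : ℕ => r ^ k * Real.Gamma (b + σ * k) / (k.factorial : ℝ) := by
  have hy : Filter.Tendsto (fun k : ℕ => b + σ * (k : ℝ)) Filter.atTop Filter.atTop :=
    Filter.tendsto_atTop_add_const_left _ _
      (tendsto_natCast_atTop_atTop.const_mul_atTop hσ1)
  refine summable_of_ratio_norm_eventually_le (r := 1 / 2) (by norm_num) ?_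
  filter_upwards [hy.eventually_gt_atTop 0,
    (tendsto_mul_rpow_affine_div hσ1 hσ2 r b).eventually_lt_const (by norm_num : (0 : ℝ) < 1 / 2)] with k hk hlt
  have hΓ := Real.Gamma_pos_of_pos hk
  have hΓ' := Real.Gamma_pos_of_pos (by linarith : 0 < b + σ * k + σ)
  rw [show b + σ * ((k + 1 : ℕ) : ℝ) = b + σ * k + σ by push_cast; ring,
    Real.norm_of_nonneg (by positivity), Real.norm_of_nonneg (by positivity)]
  calc r ^ (k + 1) * Real.Gamma (b + σ * k + σ) / ((k + 1).factorial : ℝ)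
      ≤ r ^ (k + 1) * ((b + σ * k) ^ σ * Real.Gamma (b + σ * k)) / ((k + 1).factorial : ℝ) := by
        gcongr
        exact Gamma_add_le_rpow_mul_Gamma hσ1 hσ2 hk
    _ = r * (b + σ * k) ^ σ / ((k : ℝ) + 1)
          * (r ^ k * Real.Gamma (b + σ * k) / (k.factorial : ℝ)) := by
        rw [Nat.factorial_succ]
        push_cast
        field_simp
        ring
    _ ≤ _ := by gcongr

lemma summable_norm_wrightPhi_term {σ : ℝ} (hσ1 : 0 < σ) (hσ2 : σ < 1) (ε : ℝ) (z : ℂ) :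
    Summable fun k : ℕ =>
      ‖z ^ k / ((k.factorial : ℂ) * Complex.Gamma (-(σ : ℂ) * k + (ε : ℂ)))‖ := by
  have hy : Filter.Tendsto (fun k : ℕ => (1 - ε) + σ * (k : ℝ)) Filter.atTop Filter.atTop :=
    Filter.tendsto_atTop_add_const_left _ _
      (tendsto_natCast_atTop_atTop.const_mul_atTop hσ1)
  refine (summable_pow_mul_Gamma_affine_div_factorial hσ1 hσ2 (1 - ε)
    (norm_nonneg z)).of_norm_bounded_eventually_nat ?_
  filter_upwards [hy.eventually_gt_atTop 0] with k hk
  have h := abs_inv_Gamma_le_Gamma_one_sub (x := -σ * k + ε) (by linarith)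
  rw [show 1 - (-σ * k + ε) = 1 - ε + σ * k by ring] at h
  rw [show -(σ : ℂ) * k + (ε : ℂ) = ((-σ * k + ε : ℝ) : ℂ) by push_cast; ring,
    Complex.Gamma_ofReal, norm_norm, norm_div, norm_mul, norm_pow, Complex.norm_natCast,
    Complex.norm_real, Real.norm_eq_abs]
  calc ‖z‖ ^ k / ((k.factorial : ℝ) * |Real.Gamma (-σ * k + ε)|)
      = ‖z‖ ^ k * |(Real.Gamma (-σ * k + ε))⁻¹| / k.factorial := by
        rw [abs_inv, div_mul_eq_div_div, div_eq_mul_inv, div_mul_eq_mul_div]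
    _ ≤ _ := by gcongr

/-- Termwise integration of the Wright function:
`c ∫_0^X φ(-σ, ε, -ct) dt = 1/Γ(ε+σ) - φ(-σ, ε+σ, -cX)`. -/
theorem wright_antiderivative (σ : ℝ) (hσ1 : 0 < σ) (hσ2 : σ < 1) (ε : ℝ) (c : ℂ)
    (X : ℝ) (hX : 0 < X) :
    c * ∫ t in (0 : ℝ)..X, wrightPhi σ ε (-c * (t : ℂ))
      = 1 / Complex.Gamma ((ε : ℂ) + (σ : ℂ)) - wrightPhi σ (ε + σ) (-c * (X : ℂ)) := by
  have h_sum : HasSum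
      (fun k : ℕ => ∫ t in (0 : ℝ)..X, (-c * (t : ℂ)) ^ k /
        ((k.factorial : ℂ) * Complex.Gamma (-(σ : ℂ) * k + (ε : ℂ))))
      (∫ t in (0 : ℝ)..X, wrightPhi σ ε (-c * (t : ℂ))) := by
    refine intervalIntegral.hasSum_integral_of_dominated_convergence
      (fun k _ => ‖(-c * (X : ℂ)) ^ k /
        ((k.factorial : ℂ) * Complex.Gamma (-(σ : ℂ) * k + (ε : ℂ)))‖) (fun k => ?_) (fun k => ?_)
      ?_ intervalIntegrable_const ?_
    · exact Continuous.aestronglyMeasurable (by fun_prop)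
    · refine Filter.Eventually.of_forall fun t ht => ?_
      rw [Set.uIoc_of_le hX.le] at ht
      simp only [norm_div, norm_pow, norm_mul, Complex.norm_real, Real.norm_eq_abs,
        abs_of_pos ht.1, abs_of_pos hX]
      have := ht.1.le
      have := ht.2
      gcongr
    · exact Filter.Eventually.of_forall fun t _ => summable_norm_wrightPhi_term hσ1 hσ2 ε _
    · exact Filter.Eventually.of_forall fun t _ =>
        (summable_norm_wrightPhi_term hσ1 hσ2 ε _).of_norm.hasSum
  have h_term (k : ℕ) : c * ∫ t in (0 : ℝ)..X, (-c * (t : ℂ)) ^ k /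
        ((k.factorial : ℂ) * Complex.Gamma (-(σ : ℂ) * k + (ε : ℂ)))
      = -((-c * (X : ℂ)) ^ (k + 1) / (((k + 1).factorial : ℂ) *
        Complex.Gamma (-(σ : ℂ) * (k + 1 : ℕ) + ((ε + σ : ℝ) : ℂ)))) := by
    have h_int : ∫ t in (0 : ℝ)..X, (t : ℂ) ^ k = (X : ℂ) ^ (k + 1) / ((k : ℂ) + 1) := by
      have h : ∫ t in (0 : ℝ)..X, ((t ^ k : ℝ) : ℂ) = _ := intervalIntegral.integral_ofReal
      rw [integral_pow] at h
      simpa using h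
    rw [show -(σ : ℂ) * (k + 1 : ℕ) + ((ε + σ : ℝ) : ℂ) = -(σ : ℂ) * k + (ε : ℂ) by
      push_cast; ring]
    simp only [mul_pow, div_eq_mul_inv]
    rw [intervalIntegral.integral_mul_const, intervalIntegral.integral_const_mul, h_int,
      Nat.factorial_succ]
    push_cast
    simp only [mul_inv, pow_succ, div_eq_mul_inv]
    ring
  have h_split := (summable_norm_wrightPhi_term hσ1 hσ2 (ε + σ)
    (-c * (X : ℂ))).of_norm.tsum_eq_zero_add
  rw [← h_sum.tsum_eq, ← tsum_mul_left, tsum_congr h_term, tsum_neg, wrightPhi, h_split]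
  simp
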